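/- Let s, s' ∈ 𝒟_C be dominant states with Δ(s,s') = Γ(C) := max_{u,u' ∈ 𝒟_C} Δ(u,u'), and set S := { x ∈ 𝒳_C : Δ(s,x) < Γ(C) }. Then every x ∈ S that admits a CSMA step to some y ∈ 𝒳_C \ S satisfies a(x) = 𝒜(C) − Γ(C) + 1, and every such exiting step is a deactivation, i.e., a(y) = a(x) − 1. -/

import Mathlib

open scoped Classical

noncomputable section

namespace CSMA

/-- An activity state of a multi-channel CSMA network with `N` nodes and `C` channels:
node `i` is inactive if `x i = 0` and active on channel `c` if `x i = c` (`1 ≤ c ≤ C`). -/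
abbrev CState (N C : ℕ) := Fin N → Fin (C + 1)

/-- Feasibility of an activity state: for every channel `c` and every edge of the conflict
graph `E c`, the two endpoints are not both active on channel `c`. -/
def Feasible {N C : ℕ} (E : Fin C → SimpleGraph (Fin N)) (x : CState N C) : Prop :=
  ∀ c : Fin C, ∀ i j : Fin N, (E c).Adj i j → ¬(x i = c.succ ∧ x j = c.succ)

/-- `a(x)`: the number of active nodes in state `x`. -/
def activeCount {N C : ℕ} (x : CState N C) : ℕ :=
  (Finset.univ.filter fun i => x i ≠ 0).card

/-- The finite set `𝒳_C` of feasible activity states. -/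
def FeasibleSet {N C : ℕ} (E : Fin C → SimpleGraph (Fin N)) : Finset (CState N C) :=
  Finset.univ.filter fun x => Feasible E x

/-- `𝒜(C)`: the maximum number of simultaneously active nodes over feasible states. -/
def maxActive {N C : ℕ} (E : Fin C → SimpleGraph (Fin N)) : ℕ :=
  (FeasibleSet E).sup activeCount

/-- `𝒟_C`: the set of dominant states, i.e. feasible states with `𝒜(C)` active nodes. -/
def DominantSet {N C : ℕ} (E : Fin C → SimpleGraph (Fin N)) : Finset (CState N C) :=
  (FeasibleSet E).filter fun x => activeCount x = maxActive E

/-- A single CSMA step: both states are feasible and `y` is obtained from `x` by either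
the activation of a single inactive node on some channel, or the deactivation of a single
active node (a node cannot change channel in a single step). -/
def Step {N C : ℕ} (E : Fin C → SimpleGraph (Fin N)) (x y : CState N C) : Prop :=
  Feasible E x ∧ Feasible E y ∧
    ∃ i : Fin N, (∀ j : Fin N, j ≠ i → y j = x j) ∧
      ((x i = 0 ∧ y i ≠ 0) ∨ (x i ≠ 0 ∧ y i = 0))

/-- `ω` is a path of CSMA steps from `x` to `y` inside the feasible state space. -/
def IsPath {N C : ℕ} (E : Fin C → SimpleGraph (Fin N)) (x y : CState N C)
    (ω : List (CState N C)) : Prop :=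
  ω.head? = some x ∧ ω.getLast? = some y ∧ (∀ z ∈ ω, Feasible E z) ∧ ω.Chain' (Step E)

/-- The height of a path: `max_{z ∈ ω} (𝒜(C) − a(z))`. -/
def pathHeight {N C : ℕ} (E : Fin C → SimpleGraph (Fin N)) (ω : List (CState N C)) : ℕ :=
  (ω.map fun z => maxActive E - activeCount z).foldr max 0

/-- The communication height `Δ(x,y) = min_{ω : x → y} max_{z ∈ ω} (𝒜(C) − a(z))`. -/
def commHeight {N C : ℕ} (E : Fin C → SimpleGraph (Fin N)) (x y : CState N C) : ℕ :=
  sInf {h : ℕ | ∃ ω, IsPath E x y ω ∧ pathHeight E ω = h}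

/-- The communication height `Δ(x,D)` between a state and a set of states. -/
def commHeightSet {N C : ℕ} (E : Fin C → SimpleGraph (Fin N)) (x : CState N C)
    (D : Set (CState N C)) : ℕ :=
  sInf {h : ℕ | ∃ ω y, y ∈ D ∧ IsPath E x y ω ∧ pathHeight E ω = h}

/-- `Γ(C)`: the worst communication height between a pair of dominant states. -/
def Gamma {N C : ℕ} (E : Fin C → SimpleGraph (Fin N)) : ℕ :=
  (DominantSet E).sup fun s => (DominantSet E).sup fun s' => commHeight E s s'

/-- The normalizing constant `Z(ν)` in the homogeneous case. -/
def Zhom {N C : ℕ} (E : Fin C → SimpleGraph (Fin N)) (ν : ℝ) : ℝ :=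
  ∑ y ∈ FeasibleSet E, ν ^ activeCount y

/-- The homogeneous stationary distribution `π_C(x) = ν^{a(x)} / Z(ν)`. -/
def piHom {N C : ℕ} (E : Fin C → SimpleGraph (Fin N)) (ν : ℝ) (x : CState N C) : ℝ :=
  ν ^ activeCount x / Zhom E ν


/-- The trap `S = { x ∈ 𝒳_C : Δ(s,x) < Γ(C) }` associated with a dominant state `s`. -/
def trapSet {N C : ℕ} (E : Fin C → SimpleGraph (Fin N)) (s : CState N C) :
    Finset (CState N C) :=
  (FeasibleSet E).filter fun x => commHeight E s x < Gamma E

section Paths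

variable {N C : ℕ} {E : Fin C → SimpleGraph (Fin N)} {x y : CState N C}

theorem activeCount_of_deactivation {i : Fin N} (h : ∀ j, j ≠ i → y j = x j)
    (hx : x i ≠ 0) (hy : y i = 0) : activeCount x = activeCount y + 1 := by
  unfold activeCount
  rw [← Finset.card_insert_of_notMem (a := i) (by simp [hy])]
  congr 1
  ext j
  by_cases hj : j = i
  · subst hj; simp [hx]
  · simp [hj, h j hj]

theorem Step.symm (h : Step E x y) : Step E y x := by
  obtain ⟨hx, hy, i, hi, h⟩ := h
  exact ⟨hy, hx, i, fun j hj => (hi j hj).symm, by tauto⟩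

theorem Step.activeCount_eq (h : Step E x y) :
    activeCount y = activeCount x + 1 ∨ activeCount x = activeCount y + 1 := by
  obtain ⟨-, -, i, hi, ⟨h0, h1⟩ | ⟨h0, h1⟩⟩ := h
  · exact .inl (activeCount_of_deactivation (fun j hj => (hi j hj).symm) h1 h0)
  · exact .inr (activeCount_of_deactivation hi h0 h1)

theorem Feasible.update_zero (hx : Feasible E x) (i : Fin N) :
    Feasible E (Function.update x i 0) := by
  have key : ∀ (c : Fin C) j, Function.update x i 0 j = c.succ → x j = c.succ := by
    intro c j hj
    by_cases hji : j = i
    · subst hji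
      simp [(Fin.succ_ne_zero c).symm] at hj
    · simpa [hji] using hj
  exact fun c j k hjk hc => hx c j k hjk ⟨key c j hc.1, key c k hc.2⟩

theorem Feasible.reflTransGen_zero (hx : Feasible E x) :
    Relation.ReflTransGen (Step E) x 0 := by
  induction hn : activeCount x generalizing x with
  | zero =>
    have : x = 0 := by
      ext1 i
      by_contra hi
      have := Finset.filter_eq_empty_iff.1 (Finset.card_eq_zero.1 hn) (Finset.mem_univ i)
      exact this hi
    rw [this]
  | succ n ih =>
    obtain ⟨i, hi⟩ := Finset.card_pos.1 (hn ▸ n.succ_pos : 0 < activeCount x)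
    have hi : x i ≠ 0 := (Finset.mem_filter.1 hi).2
    have hj : ∀ j, j ≠ i → Function.update x i 0 j = x j := fun j hj => by simp [hj]
    have hstep : Step E x (Function.update x i 0) :=
      ⟨hx, hx.update_zero i, i, hj, .inr ⟨hi, by simp⟩⟩
    have hcount := activeCount_of_deactivation hj hi (by simp)
    exact .head hstep (ih (hx.update_zero i) (by omega))

theorem IsPath.concat {z : CState N C} {ω : List (CState N C)} (h : IsPath E x y ω)
    (hyz : Step E y z) : IsPath E x z (ω ++ [z]) := by
  obtain ⟨h1, h2, h3, h4⟩ := h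
  refine ⟨by simp [h1], by simp, ?_, ?_⟩
  · intro w hw
    rcases List.mem_append.1 hw with hw | hw
    · exact h3 w hw
    · rw [List.mem_singleton.1 hw]; exact hyz.2.1
  · refine List.isChain_append.2 ⟨h4, by simp, ?_⟩
    intro a ha b hb
    simp_all

theorem pathHeight_lt_iff {ω : List (CState N C)} {n : ℕ} (hn : 0 < n) :
    pathHeight E ω < n ↔ ∀ z ∈ ω, maxActive E - activeCount z < n := by
  unfold pathHeight
  induction ω with
  | nil => simpa using hn
  | cons a l ih => simp_all

theorem Feasible.exists_isPath (hx : Feasible E x) (hy : Feasible E y) :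
    ∃ ω, IsPath E x y ω := by
  have hxy : Relation.ReflTransGen (Step E) x y :=
    have : Std.Symm (Step E) := ⟨fun _ _ => Step.symm⟩
    hx.reflTransGen_zero.trans (symm hy.reflTransGen_zero)
  clear hy
  induction hxy with
  | refl => exact ⟨[x], by simp, by simp, by simpa using hx, List.isChain_singleton x⟩
  | tail _ hstep ih =>
    obtain ⟨ω, h⟩ := ih
    exact ⟨_, h.concat hstep⟩

theorem commHeight_le {ω : List (CState N C)} (h : IsPath E x y ω) :
    commHeight E x y ≤ pathHeight E ω :=
  Nat.sInf_le ⟨ω, h, rfl⟩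

theorem Feasible.exists_isPath_pathHeight_eq (hx : Feasible E x) (hy : Feasible E y) :
    ∃ ω, IsPath E x y ω ∧ pathHeight E ω = commHeight E x y := by
  obtain ⟨ω, h⟩ := hx.exists_isPath hy
  exact Nat.sInf_mem (s := {h | ∃ ω, IsPath E x y ω ∧ pathHeight E ω = h}) ⟨_, ω, h, rfl⟩

end Paths

/-- Let `s, s' ∈ 𝒟_C` be dominant states with `Δ(s,s') = Γ(C)` and set
`S = { x ∈ 𝒳_C : Δ(s,x) < Γ(C) }`. Then every `x ∈ S` admitting a CSMA step to some
`y ∈ 𝒳_C \ S` satisfies `a(x) = 𝒜(C) − Γ(C) + 1`, and every such exiting step is a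
deactivation, i.e. `a(y) = a(x) − 1`. -/
theorem trap_boundary_states (N C : ℕ) (hC : 1 ≤ C) (E : Fin C → SimpleGraph (Fin N))
    (hcard : 2 ≤ (DominantSet E).card)
    (s s' : CState N C) (hs : s ∈ DominantSet E) (hs' : s' ∈ DominantSet E)
    (hΓ : commHeight E s s' = Gamma E) :
    ∀ x : CState N C, Feasible E x → commHeight E s x < Gamma E →
      ∀ y : CState N C, Feasible E y → ¬commHeight E s y < Gamma E →
        Step E x y →
          activeCount x = maxActive E - Gamma E + 1 ∧
          activeCount y = activeCount x - 1 := by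
  intro x hx hxS y _ hyS hstep
  have hs : Feasible E s := (Finset.mem_filter.1 (Finset.mem_filter.1 hs).1).2
  have hpos : 0 < Gamma E := by omega
  obtain ⟨ω, hω, hh⟩ := hs.exists_isPath_pathHeight_eq hx
  have hωlt := (pathHeight_lt_iff hpos).1 (hh.trans_lt hxS)
  have hax := hωlt x (List.mem_of_getLast? hω.2.1)
  have hay : Gamma E ≤ maxActive E - activeCount y := by
    by_contra! hlt
    refine hyS ((commHeight_le (hω.concat hstep)).trans_lt ((pathHeight_lt_iff hpos).2 ?_))
    intro z hz
    rcases List.mem_append.1 hz with hz | hz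
    · exact hωlt z hz
    · rwa [List.mem_singleton.1 hz]
  have := hstep.activeCount_eq
  omega

end CSMA
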